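/- arXiv:1510.02585 — 3 statements merged into one kernel-verified Lean document; each statement's English description precedes it below -/
import Mathlib

section
/- Let V be an n-dimensional vector space over an algebraically closed field k and let W be a subspace of ∧^m V with 0 < m < n. If codim W ≤ m(n−m), then W is realizable, i.e., there exists an m-dimensional subspace V₁ of V such that ∧^m V₁ ∈ W (as a line). -/
open Module ExteriorAlgebra

variable {k G V : Type*} [Field k] [AddCommGroup V] [Module k V] [Group G]

/-- A representation is `m`-thick (with `n = dim V`). -/
def IsMThick (ρ : G →* (V ≃ₗ[k] V)) (n m : ℕ) : Prop :=
  ∀ V₁ V₂ : Submodule k V,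
    Module.finrank k V₁ = m → Module.finrank k V₂ = n - m →
    ∃ g : G, IsCompl (V₁.map (ρ g : V →ₗ[k] V)) V₂

/-- Invariance of a subspace under the representation. -/
def RepInvariant (ρ : G →* (V ≃ₗ[k] V)) (W : Submodule k V) : Prop :=
  ∀ g : G, W.map (ρ g : V →ₗ[k] V) ≤ W

/-- Irreducibility of a representation. -/
def IsIrreducibleRep (ρ : G →* (V ≃ₗ[k] V)) : Prop :=
  Nontrivial V ∧ ∀ W : Submodule k V, RepInvariant ρ W → W = ⊥ ∨ W = ⊤

/-- The induced action on the exterior algebra. -/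
noncomputable def extAction (ρ : G →* (V ≃ₗ[k] V)) (g : G) :
    ExteriorAlgebra k V →ₗ[k] ExteriorAlgebra k V :=
  (ExteriorAlgebra.map (ρ g : V →ₗ[k] V)).toLinearMap

/-- A representation is `m`-dense if the induced representation on `⋀^m V` is irreducible. -/
def IsMDense (ρ : G →* (V ≃ₗ[k] V)) (m : ℕ) : Prop :=
  ∀ W : Submodule k (ExteriorAlgebra k V), W ≤ ⋀[k]^m V →
    (∀ g : G, W.map (extAction ρ g) ≤ W) → W = ⊥ ∨ W = ⋀[k]^m V

/-- A subspace of `⋀^m V` is realizable if it contains a nonzero decomposable vector. -/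
def IsRealizable (k : Type*) [Field k] {V : Type*} [AddCommGroup V] [Module k V]
    (m : ℕ) (W : Submodule k (ExteriorAlgebra k V)) : Prop :=
  ∃ v : Fin m → V, ExteriorAlgebra.ιMulti k m v ≠ 0 ∧ ExteriorAlgebra.ιMulti k m v ∈ W

/-- The perp of a subspace of `⋀^m V` inside `⋀^j V` with respect to the wedge pairing. -/
def wedgePerp (W : Submodule k (ExteriorAlgebra k V)) (j : ℕ) :
    Submodule k (ExteriorAlgebra k V) where
  carrier := {y | y ∈ ⋀[k]^j V ∧ ∀ x ∈ W, x * y = 0}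
  add_mem' := by
    rintro a b ⟨ha, ha'⟩ ⟨hb, hb'⟩
    exact ⟨add_mem ha hb, fun x hx => by rw [mul_add, ha' x hx, hb' x hx, add_zero]⟩
  zero_mem' := ⟨Submodule.zero_mem _, fun x _ => mul_zero x⟩
  smul_mem' := by
    rintro c a ⟨ha, ha'⟩
    exact ⟨Submodule.smul_mem _ c ha, fun x hx => by rw [mul_smul_comm, ha' x hx, smul_zero]⟩

namespace Realiz

theorem exists_point {K R : Type*} [Field K] [IsAlgClosed K] [CommRing R] [Algebra K R]
    [Algebra.FiniteType K R] (P : Ideal R) [hP : P.IsPrime] (x : R) (hx : x ∉ P) :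
    ∃ φ : R →ₐ[K] K, (∀ y ∈ P, φ y = 0) ∧ φ x ≠ 0 := by
  have hJ : IsJacobsonRing R := isJacobsonRing_of_finiteType (A := K)
  have h1 : P.jacobson = P := hJ.out hP.isRadical
  have h2 : x ∉ P.jacobson := by rwa [h1]
  obtain ⟨M, hM, hxM⟩ : ∃ M : Ideal R, (P ≤ M ∧ M.IsMaximal) ∧ x ∉ M := by
    by_contra! hcon
    exact h2 (Submodule.mem_sInf.2 fun M hM => hcon M hM)
  have := hM.2
  let _ : Field (R ⧸ M) := Ideal.Quotient.field M
  have : Algebra.FiniteType K (R ⧸ M) := inferInstance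
  have : Module.Finite K (R ⧸ M) := finite_of_finite_type_of_isJacobsonRing K (R ⧸ M)
  let ψ : (R ⧸ M) →ₐ[K] K := IsAlgClosed.lift
  refine ⟨ψ.comp (Ideal.Quotient.mkₐ K M), fun y hy => ?_, fun h => hxM ?_⟩
  · have : Ideal.Quotient.mkₐ K M y = 0 := Ideal.Quotient.eq_zero_iff_mem.2 (hM.1 hy)
    rw [AlgHom.comp_apply, this, map_zero]
  · apply Ideal.Quotient.eq_zero_iff_mem.1
    apply ψ.toRingHom.injective
    simpa using h

variable (K : Type*) [Field K] (m n : ℕ)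

/-- generic matrix -/
noncomputable def gen : Matrix (Fin m) (Fin n) (MvPolynomial (Fin m × Fin n) K) :=
  Matrix.of fun i j => MvPolynomial.X (i, j)

noncomputable def pl (J : Fin m → Fin n) : MvPolynomial (Fin m × Fin n) K :=
  ((gen K m n).submatrix id J).det

noncomputable abbrev PR := Algebra.adjoin K (Set.range (pl K m n))

noncomputable def pr (J : Fin m → Fin n) : PR K m n :=
  ⟨pl K m n J, Algebra.subset_adjoin ⟨J, rfl⟩⟩

instance : Algebra.FiniteType K (PR K m n) :=
  (Subalgebra.fg_iff_finiteType _).1 (Subalgebra.fg_def.2 ⟨_, Set.finite_range _, rfl⟩)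

instance : IsNoetherianRing (PR K m n) := Algebra.FiniteType.isNoetherianRing K _

variable {m n}

theorem det_rel {R : Type*} [CommRing R] (X : Matrix (Fin m) (Fin n) R) (I J : Fin m → Fin n) :
    (Matrix.of fun i l => (X.submatrix id (Function.update I i (J l))).det).det =
      (X.submatrix id I).det ^ (m - 1) * (X.submatrix id J).det := by
  have : (Matrix.of fun i l => (X.submatrix id (Function.update I i (J l))).det) =
      (X.submatrix id I).adjugate * X.submatrix id J := by
    ext i l
    have h : X.submatrix id (Function.update I i (J l)) =
        (X.submatrix id I).updateCol i (fun a => X a (J l)) := by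
      ext a b
      by_cases hb : b = i
      · subst hb; simp
      · simp [hb]
    rw [Matrix.of_apply, h, ← Matrix.cramer_apply, Matrix.cramer_eq_adjugate_mulVec]
    rfl
  rw [this, Matrix.det_mul, Matrix.det_adjugate, Fintype.card_fin]

/-- truncation -/
noncomputable def tr (c : Fin m → ℕ) :
    MvPolynomial (Fin m × Fin n) K →ₐ[K] MvPolynomial (Fin m × Fin n) K :=
  MvPolynomial.aeval fun x => if (x.2 : ℕ) ≤ c x.1 then MvPolynomial.X x else 0

noncomputable def Q (c : Fin m → ℕ) : Ideal (PR K m n) :=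
  RingHom.ker ((tr K (n := n) c).comp (PR K m n).val)

instance (c : Fin m → ℕ) : (Q K (n := n) c).IsPrime := RingHom.ker_isPrime _

noncomputable def Z (m n : ℕ) : PR K m n →ₐ[K] K :=
  (MvPolynomial.aeval (fun _ : Fin m × Fin n => (0 : K))).comp (PR K m n).val

theorem Q_mono {c c' : Fin m → ℕ} (h : c' ≤ c) : Q K (n := n) c ≤ Q K (n := n) c' := by
  have : (tr K (n := n) c').comp (tr K c) = tr K c' := by
    apply MvPolynomial.algHom_ext
    intro x
    have h0 : c' x.1 ≤ c x.1 := h x.1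
    by_cases h1 : (x.2 : ℕ) ≤ c x.1
    · simp [tr, h1]
    · have h2 : ¬ (x.2 : ℕ) ≤ c' x.1 := by omega
      simp [tr, h1, h2]
  intro a ha
  have ha' : tr K c (a : MvPolynomial (Fin m × Fin n) K) = 0 := ha
  change tr K c' (a : MvPolynomial (Fin m × Fin n) K) = 0
  rw [← this, AlgHom.comp_apply, ha', map_zero]

theorem Q_le_Z (c : Fin m → ℕ) : Q K (n := n) c ≤ RingHom.ker (Z K m n) := by
  have : (MvPolynomial.aeval (fun _ : Fin m × Fin n => (0 : K))).comp (tr K c) =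
      MvPolynomial.aeval (fun _ : Fin m × Fin n => (0 : K)) := by
    apply MvPolynomial.algHom_ext
    intro x
    by_cases h1 : (x.2 : ℕ) ≤ c x.1 <;> simp [tr, h1]
  intro a ha
  have ha' : tr K c (a : MvPolynomial (Fin m × Fin n) K) = 0 := ha
  change MvPolynomial.aeval (fun _ : Fin m × Fin n => (0 : K))
    (a : MvPolynomial (Fin m × Fin n) K) = 0
  rw [← this, AlgHom.comp_apply, ha', map_zero]

theorem Z_pr (hm : 0 < m) (J : Fin m → Fin n) : Z K m n (pr K m n J) = 0 := by
  change MvPolynomial.aeval (fun _ : Fin m × Fin n => (0 : K)) (pl K m n J) = 0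
  rw [pl, AlgHom.map_det]
  have : Nonempty (Fin m) := ⟨⟨0, hm⟩⟩
  convert Matrix.det_zero (n := Fin m) (R := K)
  ext i j
  simp [gen]

theorem pr_notMem (J : Fin m → Fin n) (hJ : StrictMono J) :
    pr K m n J ∉ Q K (n := n) (fun i => (J i : ℕ)) := by
  intro h
  have h' : tr K (fun i => (J i : ℕ)) (pl K m n J) = 0 := h
  have h2 := congrArg (MvPolynomial.aeval
    (fun x : Fin m × Fin n => if x.2 = J x.1 then (1 : K) else 0)) h'
  rw [map_zero, pl, AlgHom.map_det, AlgHom.map_det] at h2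
  have : (1 : Matrix (Fin m) (Fin m) K).det = 0 := by
    rw [← h2]
    congr 1
    ext i j
    by_cases hij : i = j
    · subst hij; simp [gen, tr]
    · have : J j ≠ J i := fun e => hij (hJ.injective e).symm
      by_cases h3 : J j ≤ J i <;> simp [gen, tr, hij, this, h3]
  simp at this

theorem pr_mem (J : Fin m → Fin n) (hJ : Monotone J) (c : Fin m → ℕ) (hc : Monotone c)
    (i₀ : Fin m) (hi : c i₀ < J i₀) :
    pr K m n J ∈ Q K (n := n) c := by
  change tr K c (pl K m n J) = 0
  rw [pl, AlgHom.map_det, Matrix.det_apply]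
  apply Finset.sum_eq_zero
  intro σ _
  obtain ⟨l, hl, hσ⟩ : ∃ l, i₀ ≤ l ∧ σ l ≤ i₀ := by
    by_contra! hcon
    have : (Finset.Ici i₀).card ≤ (Finset.Ioi i₀).card :=
      Finset.card_le_card_of_injOn σ (fun l hl => by
        simpa using hcon l (by simpa using hl)) σ.injective.injOn
    simp at this
    omega
  rw [Finset.prod_eq_zero (Finset.mem_univ l), smul_zero]
  have h1 : ¬ ((J l : ℕ) ≤ c (σ l)) := by
    have := hc hσ
    have : (J i₀ : ℕ) ≤ J l := hJ hl
    omega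
  simp [gen, tr, h1]

/-- chain -/
def ch (m n t : ℕ) (i : Fin m) : ℕ := i + min (t - (m - 1 - i) * (n - m)) (n - m)

theorem ch_strictMono (t : ℕ) : StrictMono (ch m n t) := by
  intro i j hij
  have h : (i : ℕ) < j := hij
  have : (m - 1 - (j : ℕ)) * (n - m) ≤ (m - 1 - (i : ℕ)) * (n - m) :=
    Nat.mul_le_mul_right _ (by omega)
  unfold ch
  omega

theorem ch_lt (hmn : m < n) (t : ℕ) (i : Fin m) : ch m n t i < n := by
  unfold ch
  have := i.2
  omega

theorem ch_mono (t : ℕ) : ch m n t ≤ ch m n (t + 1) := by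
  intro i
  change (i : ℕ) + min (t - (m - 1 - i) * (n - m)) (n - m) ≤
    i + min (t + 1 - (m - 1 - i) * (n - m)) (n - m)
  omega

theorem ch_step (hm0 : 0 < m) (hmn : m < n) (t : ℕ) (ht : t < m * (n - m)) :
    ∃ i, ch m n t i < ch m n (t + 1) i := by
  have hq : t / (n - m) < m := Nat.div_lt_of_lt_mul (by rwa [mul_comm] at ht)
  have h2 := Nat.div_add_mod' t (n - m)
  generalize t / (n - m) = u at hq h2
  refine ⟨⟨m - 1 - u, by omega⟩, ?_⟩
  have h1 : m - 1 - (m - 1 - u) = u := by omega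
  have h3 := Nat.mod_lt t (show n - m > 0 by omega)
  unfold ch
  simp only [h1]
  omega

theorem height_Q (hm0 : 0 < m) (hmn : m < n) (s : ℕ) (hs : s ≤ m * (n - m)) :
    (s : ℕ∞) ≤ (Q K (n := n) (ch m n (m * (n - m) - s))).height := by
  induction s with
  | zero => simp
  | succ s ih =>
    have ih := ih (by omega)
    obtain ⟨t, ht⟩ : ∃ t, t = m * (n - m) - (s + 1) := ⟨_, rfl⟩
    have e : m * (n - m) - s = t + 1 := by omega
    rw [e] at ih
    rw [← ht]
    obtain ⟨i, hi⟩ := ch_step hm0 hmn t (by omega)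
    let J : Fin m → Fin n := fun i => ⟨ch m n (t + 1) i, ch_lt hmn _ _⟩
    have hJ : StrictMono J := fun a b h => ch_strictMono (t + 1) h
    have hlt : Q K (n := n) (ch m n (t + 1)) < Q K (n := n) (ch m n t) := by
      refine lt_of_le_of_ne (Q_mono K (ch_mono t)) fun heq => ?_
      have h1 : pr K m n J ∉ Q K (n := n) (ch m n (t + 1)) := pr_notMem K J hJ
      rw [heq] at h1
      exact h1 (pr_mem K J hJ.monotone _ (ch_strictMono t).monotone i hi)
    have := Ideal.height_add_one_le_of_lt_of_isPrime hlt
    push_cast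
    exact (add_le_add_left ih 1).trans this

theorem height_Z (hm0 : 0 < m) (hmn : m < n) :
    ((m * (n - m) + 1 : ℕ) : ℕ∞) ≤ (RingHom.ker (Z K m n)).height := by
  have h := height_Q K hm0 hmn (m * (n - m)) le_rfl
  have : (RingHom.ker (Z K m n)).IsPrime := RingHom.ker_isPrime _
  rw [Nat.sub_self] at h
  let J : Fin m → Fin n := fun i => ⟨ch m n 0 i, ch_lt hmn _ _⟩
  have hJ : StrictMono J := fun a b h => ch_strictMono 0 h
  have hlt : Q K (n := n) (ch m n 0) < RingHom.ker (Z K m n) := by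
    refine lt_of_le_of_ne (Q_le_Z K _) fun heq => ?_
    have h1 : pr K m n J ∉ Q K (n := n) (ch m n 0) := pr_notMem K J hJ
    rw [heq] at h1
    exact h1 (Z_pr K hm0 J)
  have := Ideal.height_add_one_le_of_lt_of_isPrime hlt
  push_cast at h ⊢
  exact (add_le_add_left h 1).trans this

theorem ker_Z_le (hm0 : 0 < m) (P : Ideal (PR K m n)) (hP : ∀ J, pr K m n J ∈ P) :
    RingHom.ker (Z K m n) ≤ P := by
  have : Ideal.Quotient.mkₐ K P = (Algebra.ofId K _).comp (Z K m n) := by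
    apply AlgHom.adjoin_ext
    rintro _ ⟨J, rfl⟩
    rw [AlgHom.comp_apply]
    change Ideal.Quotient.mkₐ K P (pr K m n J) = Algebra.ofId K _ (Z K m n (pr K m n J))
    rw [Z_pr K hm0, map_zero]
    exact Ideal.Quotient.eq_zero_iff_mem.2 (hP J)
  intro a ha
  have ha : Z K m n a = 0 := ha
  apply Ideal.Quotient.eq_zero_iff_mem.1
  change Ideal.Quotient.mkₐ K P a = 0
  rw [this, AlgHom.comp_apply, ha, map_zero]

theorem core [IsAlgClosed K] (hm0 : 0 < m) (hmn : m < n) {ι σ : Type*} [Fintype ι] [Fintype σ]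
    (hc : Fintype.card σ ≤ m * (n - m))
    (g : ι → Fin m → Fin n) (q : σ → ι → K) :
    ∃ (A : Matrix (Fin m) (Fin n) K) (J₀ : Fin m → Fin n), (A.submatrix id J₀).det ≠ 0 ∧
      ∀ s, ∑ i, q s i * (A.submatrix id (g i)).det = 0 := by
  classical
  let f : σ → PR K m n := fun s => ∑ i, q s i • pr K m n (g i)
  have hmp : (RingHom.ker (Z K m n)).IsPrime := RingHom.ker_isPrime _
  have hle : Ideal.span ((Finset.univ.image f : Finset (PR K m n)) : Set (PR K m n)) ≤
      RingHom.ker (Z K m n) := by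
    rw [Ideal.span_le]
    intro x hx
    obtain ⟨s, rfl⟩ : ∃ s, f s = x := by simpa using hx
    change Z K m n (f s) = 0
    simp [f, Z_pr K hm0]
  obtain ⟨P, hP, hPle⟩ := Ideal.exists_minimalPrimes_le hle
  have hPp : P.IsPrime := hP.isPrime
  have hht := Ideal.height_le_card_of_mem_minimalPrimes_span_finset hP
  obtain ⟨J₀, hJ₀⟩ : ∃ J, pr K m n J ∉ P := by
    by_contra! hcon
    have heq : P = RingHom.ker (Z K m n) := le_antisymm hPle (ker_Z_le K hm0 P hcon)
    rw [heq] at hht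
    have h1 := (height_Z K hm0 hmn).trans hht
    have h2 : (Finset.univ.image f).card ≤ Fintype.card σ := Finset.card_image_le
    have h3 : m * (n - m) + 1 ≤ (Finset.univ.image f).card := by exact_mod_cast h1
    omega
  obtain ⟨φ, hφ, hφ0⟩ := exists_point (K := K) P _ hJ₀
  let A : Matrix (Fin m) (Fin n) K :=
    Matrix.of fun i j => φ (pr K m n (Function.update J₀ i j))
  have hA : ∀ J : Fin m → Fin n, (A.submatrix id J).det =
      φ (pr K m n J₀) ^ (m - 1) * φ (pr K m n J) := by
    intro J
    have hrel : (Matrix.of fun i l => pr K m n (Function.update J₀ i (J l))).det =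
        pr K m n J₀ ^ (m - 1) * pr K m n J := by
      apply Subtype.val_injective
      change (PR K m n).val (Matrix.of fun i l => pr K m n (Function.update J₀ i (J l))).det =
        (PR K m n).val (pr K m n J₀ ^ (m - 1) * pr K m n J)
      rw [AlgHom.map_det, map_mul, map_pow]
      exact det_rel (gen K m n) J₀ J
    rw [← map_pow, ← map_mul, ← hrel, AlgHom.map_det]
    rfl
  refine ⟨A, J₀, ?_, fun s => ?_⟩
  · rw [hA]
    exact mul_ne_zero (pow_ne_zero _ hφ0) hφ0
  · have h1 : φ (f s) = 0 := hφ _ (hP.1.2 (Ideal.subset_span (by simp)))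
    simp only [f, map_sum, map_smul, smul_eq_mul] at h1
    calc _ = φ (pr K m n J₀) ^ (m - 1) * ∑ i, q s i * φ (pr K m n (g i)) := by
          rw [Finset.mul_sum]
          refine Finset.sum_congr rfl fun i _ => ?_
          rw [hA]; ring
      _ = 0 := by rw [h1, mul_zero]

end Realiz

/-- over an algebraically closed field, a subspace of `⋀^m V` of
codimension at most `m(n-m)` is realizable. -/
theorem realizable_of_small_codim {k V : Type*} [Field k] [IsAlgClosed k]
    [AddCommGroup V] [Module k V] [FiniteDimensional k V] {n m : ℕ}
    (hn : Module.finrank k V = n) (hm0 : 0 < m) (hmn : m < n)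
    (W : Submodule k (ExteriorAlgebra k V)) (hW : W ≤ ⋀[k]^m V)
    (hcodim : Module.finrank k (⋀[k]^m V : Submodule k (ExteriorAlgebra k V)) ≤
      Module.finrank k W + m * (n - m)) :
    IsRealizable k m W := by
  let b : Basis (Fin n) k V := Module.finBasisOfFinrankEq k V hn
  let W' : Submodule k (⋀[k]^m V) := W.comap (⋀[k]^m V).subtype
  have hfW : Module.finrank k W' = Module.finrank k W :=
    (Submodule.comapSubtypeEquivOfLe hW).finrank_eq
  have hB := b.exteriorPower m
  have hfin : Module.Finite k (⋀[k]^m V) := Module.Finite.of_basis hB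
  have hq := Submodule.finrank_quotient_add_finrank W'
  let e := Module.finBasis k ((⋀[k]^m V) ⧸ W')
  obtain ⟨A, J₀, hJ₀, hA⟩ := Realiz.core k hm0 hmn
    (σ := Fin (Module.finrank k ((⋀[k]^m V) ⧸ W')))
    (by rw [Fintype.card_fin]; omega)
    (fun s : Set.powersetCard (Fin n) m => (Set.powersetCard.ofFinEmbEquiv.symm s : Fin m → Fin n))
    (fun s i => e.coord s (W'.mkQ (b.exteriorPower m i)))
  let v : Fin m → V := fun i => ∑ j, A i j • b j
  have hv : ∀ i j, b.coord j (v i) = A i j := by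
    intro i j
    have : b.repr (v i) j = A i j := by
      simp only [v]
      rw [b.repr_sum_self]
    simpa using this
  have hne : exteriorPower.ιMulti k m v ≠ 0 := by
    intro h0
    have h1 := congrArg
      (exteriorPower.pairingDual k V m (exteriorPower.ιMulti k m (fun l => b.coord (J₀ l)))) h0
    rw [map_zero, exteriorPower.pairingDual_ιMulti_ιMulti] at h1
    apply hJ₀
    rw [← h1]
    congr 1
    ext i j
    simp [hv, -Basis.coord_apply]
  have hmem : exteriorPower.ιMulti k m v ∈ W' := by
    rw [← Submodule.Quotient.mk_eq_zero, ← Submodule.mkQ_apply]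
    apply e.ext_elem
    intro s
    rw [← (b.exteriorPower m).sum_repr (exteriorPower.ιMulti k m v)]
    rw [map_zero, Finsupp.zero_apply, ← Basis.coord_apply]
    rw [map_sum, map_sum, ← hA s]
    refine Finset.sum_congr rfl fun i _ => ?_
    rw [map_smul, map_smul, exteriorPower.basis_repr_apply, exteriorPower.ιMultiDual_apply_ιMulti,
      smul_eq_mul, mul_comm]
    congr 2
    ext a c
    simp [hv, -Basis.coord_apply]
  refine ⟨v, fun h => hne (Subtype.ext ?_), ?_⟩
  · simpa using h
  · simpa [W'] using hmem
end

section
/- Let V be an n-dimensional vector space over an algebraically closed field k and ρ: G → GL(V) a representation. If ∧^m V has a nonzero G-invariant realizable subspace W with dim W ≤ m(n−m), then ρ is not m-thick. -/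
open Module ExteriorAlgebra

variable {k G V : Type*} [Field k] [AddCommGroup V] [Module k V] [Group G]

noncomputable def extForm {k R σ : Type*} [Field k] [CommRing R] [Fintype σ] [DecidableEq σ]
    {r : ℕ} (c : k →+* R) (φ : (σ → k) [⋀^Fin r]→ₗ[k] k) : (σ → R) [⋀^Fin r]→ₗ[R] R :=
  { (∑ J : Fin r → σ, c (φ (fun i => Pi.single (J i) 1)) •
      (MultilinearMap.mkPiAlgebra R (Fin r) R).compLinearMap
        (fun i => LinearMap.proj (J i)) : MultilinearMap R (fun _ : Fin r => σ → R) R) with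
    map_eq_zero_of_eq' := by
      intro v a b hv hab
      simp only [MultilinearMap.toFun_eq_coe, sum_apply, smul_apply,
        MultilinearMap.compLinearMap_apply, MultilinearMap.mkPiAlgebra_apply, LinearMap.proj_apply,
        smul_eq_mul]
      refine Finset.sum_involution (fun J _ => J ∘ Equiv.swap a b) ?_ ?_ ?_ ?_
      · intro J _
        have h1 : φ (fun i => Pi.single ((J ∘ Equiv.swap a b) i) 1)
            = - φ (fun i => Pi.single (J i) 1) :=
          φ.map_swap (fun i => Pi.single (J i) 1) hab
        have h2 : ∏ i, v i ((J ∘ Equiv.swap a b) i) = ∏ i, v i (J i) := by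
          rw [← Equiv.prod_comp (Equiv.swap a b)]
          refine Finset.prod_congr rfl fun i _ => ?_
          have key : v (Equiv.swap a b i) = v i := by
            rcases eq_or_ne i a with rfl | hia
            · rw [Equiv.swap_apply_left, hv]
            rcases eq_or_ne i b with rfl | hib
            · rw [Equiv.swap_apply_right, hv]
            rw [Equiv.swap_apply_of_ne_of_ne hia hib]
          simp only [Function.comp, Equiv.swap_apply_self, key]
        rw [h1, h2]; simp
      · intro J _ hJ heq
        apply hJ
        have : J a = J b := by
          have := congrFun heq b
          simpa using this
        rw [φ.map_eq_zero_of_eq _ (i := a) (j := b) (by simp [this]) hab]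
        simp
      · simp
      · intro J _
        funext i
        simp }

theorem extForm_apply {k R σ : Type*} [Field k] [CommRing R] [Fintype σ] [DecidableEq σ]
    {r : ℕ} (c : k →+* R) (φ : (σ → k) [⋀^Fin r]→ₗ[k] k) (u : Fin r → σ → R) :
    extForm c φ u = ∑ J : Fin r → σ, c (φ (fun i => Pi.single (J i) 1)) * ∏ i, u i (J i) := by
  change (∑ J : Fin r → σ, c (φ (fun i => Pi.single (J i) 1)) •
      (MultilinearMap.mkPiAlgebra R (Fin r) R).compLinearMap
        (fun i => LinearMap.proj (J i)) : MultilinearMap R (fun _ : Fin r => σ → R) R) u = _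
  simp

theorem extForm_map {k R R' σ : Type*} [Field k] [CommRing R] [CommRing R'] [Fintype σ]
    [DecidableEq σ] {r : ℕ} (c : k →+* R) (h : R →+* R') (φ : (σ → k) [⋀^Fin r]→ₗ[k] k)
    (u : Fin r → σ → R) :
    extForm (h.comp c) φ (fun i j => h (u i j)) = h (extForm c φ u) := by
  simp [extForm_apply]

theorem extForm_id {k σ : Type*} [Field k] [Fintype σ] [DecidableEq σ]
    {r : ℕ} (φ : (σ → k) [⋀^Fin r]→ₗ[k] k) (u : Fin r → σ → k) :
    extForm (RingHom.id k) φ u = φ u := by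
  rw [extForm_apply]
  have hu : u = fun i => ∑ j, u i j • (Pi.single j 1 : σ → k) := by
    funext i j
    simp [Pi.single_apply]
  conv_rhs => rw [hu]
  change _ = φ.toMultilinearMap _
  rw [MultilinearMap.map_sum]
  refine Finset.sum_congr rfl fun J _ => ?_
  rw [MultilinearMap.map_smul_univ φ.toMultilinearMap (fun i => u i (J i))
    (fun i => (Pi.single (J i) 1 : σ → k))]
  simp [mul_comm]

theorem extForm_mul {k R σ : Type*} [Field k] [CommRing R] [Fintype σ]
    [DecidableEq σ] {r : ℕ} (c : k →+* R) (φ : (σ → k) [⋀^Fin r]→ₗ[k] k)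
    (A : Matrix (Fin r) (Fin r) R) (M : Matrix (Fin r) σ R) :
    extForm c φ (A * M) = A.det * extForm c φ M := by
  have h := ((extForm c φ).compLinearMap (Matrix.vecMulLinear M)).eq_smul_basis_det
    (Pi.basisFun R (Fin r))
  have e1 : (fun i => Matrix.vecMulLinear M (A i)) = (A * M) := by
    funext i; simp [Matrix.mul_apply_eq_vecMul]
  have e2 : (fun i => Matrix.vecMulLinear M (Pi.basisFun R (Fin r) i)) = M := by
    funext i; simp; rfl
  have h' : extForm c φ (fun i => Matrix.vecMulLinear M (A i)) =
      extForm c φ (fun i => Matrix.vecMulLinear M (Pi.basisFun R (Fin r) i)) *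
        (Pi.basisFun R (Fin r)).det (fun i j => A i j) :=
    DFunLike.congr_fun h (fun i j => A i j)
  rw [e2, e1, mul_comm, Pi.basisFun_det_apply] at h'
  exact h'

theorem exists_common_zero {k : Type*} [Field k] [IsAlgClosed k] {r m d : ℕ} (hd : d ≤ m * r)
    (φ : Fin d → (Fin r ⊕ Fin m → k) [⋀^Fin r]→ₗ[k] k) :
    ∃ N : Fin r → (Fin r ⊕ Fin m → k), LinearIndependent k N ∧ ∀ i, φ i N = 0 := by
  classical
  let Q := MvPolynomial (Option (Fin r × Fin m)) k
  let F := FractionRing Q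
  let z : Option (Fin r × Fin m) → F := fun o => algebraMap Q F (MvPolynomial.X o)
  let t : F := z none
  have hinj : Function.Injective (algebraMap Q F) := IsFractionRing.injective Q F
  have ht : t ≠ 0 := by
    intro h
    exact MvPolynomial.X_ne_zero (R := k) (none : Option (Fin r × Fin m))
      (hinj (by rw [map_zero]; exact h))
  let U : Matrix (Fin r) (Fin r ⊕ Fin m) F :=
    Matrix.fromCols 1 (Matrix.of fun i j => z (some (i, j)))
  let p : (Fin r → Fin r ⊕ Fin m) → F := fun J => t * (U.submatrix id J).det
  have hp0 : p Sum.inl = t := by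
    have : U.submatrix id Sum.inl = 1 := by ext i j; simp [U]
    simp [p, this]
  have hup : ∀ J i c, p (Function.update J i c) =
      t * Matrix.cramer (U.submatrix id J) (fun l => U l c) i := by
    intro J i c
    rw [Matrix.cramer_apply]
    simp only [p]
    congr 2
    ext a b
    by_cases hb : b = i
    · subst hb; simp
    · simp [hb]
  have hpx : ∀ i j, p (Function.update Sum.inl i (Sum.inr j)) = t * z (some (i, j)) := by
    intro i j
    have : U.submatrix id Sum.inl = 1 := by ext i j; simp [U]
    rw [hup, this, Matrix.cramer_one]
    simp [U]
  let f : Fin d → F := fun i => t * extForm (algebraMap k F) (φ i) U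
  let S : Subalgebra k F := Algebra.adjoin k (Set.range f)
  -- Some Plücker coordinate is not integral over `S`.
  have hex : ∃ O : ValuationSubring F, (S : Set F) ⊆ O.toSubring ∧ ∃ J, p J ∉ O := by
    by_contra hcon
    push Not at hcon
    have hint : ∀ J, IsAlgebraic S (p J) := by
      intro J
      have h1 : p J ∈ (⨅ V : {V : ValuationSubring F // (S : Set F) ⊆ V.toSubring},
          V.1.toSubring) := by
        rw [Subring.mem_iInf]
        intro V
        exact hcon V.1 V.2 J
      rw [iInf_valuationSubring_superset] at h1
      obtain ⟨q, hq, hq0⟩ : IsIntegral (Subring.closure (S : Set F)) (p J) := h1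
      have hle : Subring.closure (S : Set F) ≤ S.toSubring := Subring.closure_le.2 fun _ h => h
      refine IsIntegral.isAlgebraic ⟨q.map (Subring.inclusion hle), hq.map _, ?_⟩
      rw [Polynomial.eval₂_map]
      exact hq0
    have htalg : IsAlgebraic S t := hp0 ▸ hint _
    have hzalg : ∀ o, IsAlgebraic S (z o) := by
      intro o
      cases o with
      | none => exact htalg
      | some ij =>
        have h1 := hint (Function.update Sum.inl ij.1 (Sum.inr ij.2))
        rw [hpx] at h1
        have h2 := htalg.inv.mul h1
        rwa [inv_mul_cancel_left₀ ht] at h2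
    have hQ : ∀ q : Q, IsAlgebraic S (algebraMap Q F q) := by
      intro q
      induction q using MvPolynomial.induction_on with
      | C a =>
        exact isAlgebraic_algebraMap (⟨algebraMap k F a, S.algebraMap_mem a⟩ : S)
      | add a b ha hb => rw [map_add]; exact ha.add hb
      | mul_X a o ha => rw [map_mul]; exact ha.mul (hzalg o)
    have halg : Algebra.IsAlgebraic S F := ⟨fun x => by
      obtain ⟨a, b, hb, rfl⟩ := IsFractionRing.div_surjective (A := Q) x
      rw [div_eq_mul_inv]
      exact (hQ a).mul (hQ b).inv⟩
    have h1 : Algebra.trdeg k F ≤ Cardinal.mk (Set.range f) :=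
      Algebra.IsAlgebraic.trdeg_le_cardinalMk k (Set.range f)
    have h2 : AlgebraicIndependent k z :=
      (MvPolynomial.algebraicIndependent_X (Option (Fin r × Fin m)) k).map'
        (f := IsScalarTower.toAlgHom k Q F) hinj
    have h3 := h2.lift_cardinalMk_le_trdeg
    have h4 : Cardinal.mk (Set.range f) ≤ (d : Cardinal) := by
      have := Cardinal.mk_range_le_lift (f := f)
      simpa using this
    have h5 := h3.trans (Cardinal.lift_le.2 (h1.trans h4))
    simp only [Cardinal.mk_fintype, Fintype.card_option, Fintype.card_prod, Fintype.card_fin,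
      Cardinal.lift_natCast, Nat.cast_le] at h5
    rw [mul_comm] at hd
    omega
  obtain ⟨O, hSO, J₀, hJ₀⟩ := hex
  have : Nonempty (Fin r → Fin r ⊕ Fin m) := ⟨J₀⟩
  obtain ⟨J, hJ⟩ := Finite.exists_max (fun J => O.valuation (p J))
  have hv : 1 < O.valuation (p J) := by
    refine lt_of_lt_of_le ?_ (hJ J₀)
    rw [← not_le, O.valuation_le_one_iff]
    exact hJ₀
  have hpJ : p J ≠ 0 := by
    intro h; rw [h, map_zero] at hv; exact absurd hv (not_lt.2 zero_le_one)
  let M : Matrix (Fin r) (Fin r ⊕ Fin m) F := fun i c => p (Function.update J i c) / p J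
  have hMO : ∀ i c, M i c ∈ O := by
    intro i c
    rw [← O.valuation_le_one_iff]
    simp only [M, map_div₀]
    exact div_le_one_of_le₀ (hJ _) zero_le
  have hMcr : ∀ i c, (U.submatrix id J).det * M i c =
      Matrix.cramer (U.submatrix id J) (fun l => U l c) i := by
    intro i c
    have hd0 : (U.submatrix id J).det ≠ 0 := fun h => hpJ (by simp [p, h])
    have key : ∀ a t c : F, a ≠ 0 → t ≠ 0 → a * (t * c / (t * a)) = c := by
      intro a t c ha ht
      rw [mul_div_mul_left _ _ ht, mul_div_cancel₀ _ ha]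
    change (U.submatrix id J).det * (p (Function.update J i c) / p J) = _
    rw [hup]
    exact key _ _ _ hd0 ht
  have hdet : (U.submatrix id J).det ≠ 0 := fun h => hpJ (by simp [p, h])
  have hAM : U.submatrix id J * M = U := by
    ext a c
    have h1 := congrFun (Matrix.mulVec_cramer (U.submatrix id J) (fun l => U l c)) a
    apply mul_left_cancel₀ hdet
    simp only [Pi.smul_apply, smul_eq_mul] at h1
    rw [← h1, Matrix.mul_apply, Finset.mul_sum, Matrix.mulVec, dotProduct]
    refine Finset.sum_congr rfl fun l _ => ?_
    rw [← hMcr]; ring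
  have hMJ : ∀ i l, M i (J l) = if i = l then 1 else 0 := by
    intro i l
    apply mul_left_cancel₀ hdet
    rw [hMcr, Matrix.cramer_row_self (U.submatrix id J) (fun l' => U l' (J l)) l (fun j => rfl)]
    simp [Pi.single_apply]
  have hfM : ∀ i, O.valuation (extForm (algebraMap k F) (φ i) M) < 1 := by
    intro i
    have h1 : f i = p J * extForm (algebraMap k F) (φ i) M := by
      have h2 := extForm_mul (algebraMap k F) (φ i) (U.submatrix id J) M
      rw [hAM] at h2
      simp only [f, p]
      rw [h2]; ring
    have h3 : O.valuation (f i) ≤ 1 :=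
      (O.valuation_le_one_iff _).2 (hSO (Algebra.subset_adjoin ⟨i, rfl⟩))
    rw [h1, map_mul] at h3
    by_contra h4
    rw [not_lt] at h4
    exact absurd (lt_of_lt_of_le hv (le_mul_of_one_le_right' h4)) (not_lt.2 h3)
  -- Reduce to the residue field.
  let c : k →+* O := (algebraMap k F).codRestrict O.toSubring
    (fun a => hSO (S.algebraMap_mem a))
  let M' : Fin r → Fin r ⊕ Fin m → O := fun i j => ⟨M i j, hMO i j⟩
  have hres : ∀ i, IsLocalRing.residue O (extForm c (φ i) M') = 0 := by
    intro i
    rw [IsLocalRing.residue_eq_zero_iff, O.valuation_lt_one_iff]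
    have := extForm_map c O.subtype (φ i) M'
    have h2 := hfM i
    change O.valuation (O.subtype (extForm c (φ i) M')) < 1
    rw [← this]
    exact h2
  let c' : k →+* IsLocalRing.ResidueField O := (IsLocalRing.residue O).comp c
  let θ : MvPolynomial (Fin r × (Fin r ⊕ Fin m)) k →+* IsLocalRing.ResidueField O :=
    MvPolynomial.eval₂Hom c' (fun x => IsLocalRing.residue O (M' x.1 x.2))
  obtain ⟨I, hI, hle⟩ := Ideal.exists_le_maximal _ (RingHom.ker_ne_top θ)
  obtain ⟨x, rfl⟩ := MvPolynomial.isMaximal_iff_eq_vanishingIdeal_singleton.1 hI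
  have hx : ∀ q, θ q = 0 → MvPolynomial.eval x q = 0 := by
    intro q hq
    have := hle (RingHom.mem_ker.2 hq)
    rw [MvPolynomial.mem_vanishingIdeal_singleton_iff] at this
    simpa [MvPolynomial.aeval_eq_eval] using this
  let N : Fin r → Fin r ⊕ Fin m → k := fun i j => x (i, j)
  have hNJ : ∀ i l, N i (J l) = if i = l then 1 else 0 := by
    intro i l
    have h1 := hx (MvPolynomial.X (i, J l) - MvPolynomial.C (if i = l then 1 else 0)) (by
      have : M' i (J l) = if i = l then 1 else 0 := by
        apply Subtype.ext
        simp only [M']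
        rw [hMJ]
        split_ifs <;> rfl
      simp only [θ, map_sub, MvPolynomial.coe_eval₂Hom, MvPolynomial.eval₂_X,
        MvPolynomial.eval₂_C, this]
      split_ifs <;> simp)
    simp only [map_sub, MvPolynomial.eval_X, MvPolynomial.eval_C] at h1
    exact sub_eq_zero.1 h1
  refine ⟨N, ?_, ?_⟩
  · rw [Fintype.linearIndependent_iff]
    intro g hg l
    have := congrFun hg (J l)
    simpa [hNJ] using this
  · intro i
    let P : Fin r → Fin r ⊕ Fin m → MvPolynomial (Fin r × (Fin r ⊕ Fin m)) k :=
      fun a b => MvPolynomial.X (a, b)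
    have h1 := hx (extForm MvPolynomial.C (φ i) P) (by
      rw [← extForm_map, ← hres i, ← extForm_map]
      congr 1
      · congr 1
        ext a
        simp [θ, c']
      · funext a b
        simp [θ, P])
    rw [← extForm_map] at h1
    rw [← extForm_id (φ i) N, ← h1]
    congr 1
    · congr 1
      ext a
      simp
    · funext a b
      simp [P, N]

/-- if `⋀^m V` has a nonzero G-invariant realizable subspace of
dimension at most `m(n-m)`, then ρ is not m-thick. -/
theorem not_mthick_of_small_realizable {k G V : Type*} [Field k] [IsAlgClosed k]
    [AddCommGroup V] [Module k V] [Group G] [FiniteDimensional k V] {n m : ℕ}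
    (hn : Module.finrank k V = n) (hm0 : 0 < m) (hmn : m < n)
    (ρ : G →* (V ≃ₗ[k] V)) (W : Submodule k (ExteriorAlgebra k V))
    (hW : W ≤ ⋀[k]^m V) (hW0 : W ≠ ⊥)
    (hinv : ∀ g : G, W.map (extAction ρ g) ≤ W)
    (hreal : IsRealizable k m W)
    (hdim : Module.finrank k W ≤ m * (n - m)) :
    ¬ IsMThick ρ n m := by
  classical
  intro hthick
  obtain ⟨v, hv0, hvW⟩ := hreal
  obtain ⟨r, rfl⟩ : ∃ r, n = m + r := ⟨n - m, by omega⟩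
  rw [Nat.add_sub_cancel_left] at hdim
  have hfd : FiniteDimensional k W := by
    have : FiniteDimensional k (⋀[k]^m V) := inferInstance
    exact Submodule.finiteDimensional_of_le hW
  let b : Basis (Fin (m + r)) k V := Module.finBasisOfFinrankEq k V hn
  let b' : Basis (Fin r ⊕ Fin m) k V := b.reindex ((finSumFinEquiv.symm.trans (Equiv.sumComm _ _)))
  let w : Basis (Fin (finrank k W)) k W := Module.finBasis k W
  let alt : ∀ i, V [⋀^Fin i]→ₗ[k] k := fun i => if h : m + r = i then h ▸ b.det else 0
  have halt : alt (m + r) = b.det := by simp [alt]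
  let ψ : ExteriorAlgebra k V →ₗ[k] k := ExteriorAlgebra.liftAlternating alt
  have hψ : ∀ x : Fin (m + r) → V, ψ (ExteriorAlgebra.ιMulti k (m + r) x) = b.det x := by
    intro x
    rw [← halt]
    exact ExteriorAlgebra.liftAlternating_apply_ιMulti alt x
  let φ : Fin (finrank k W) → (Fin r ⊕ Fin m → k) [⋀^Fin r]→ₗ[k] k := fun i =>
    ((ψ ∘ₗ LinearMap.mulLeft k (w i : ExteriorAlgebra k V)).compAlternatingMap
      (ExteriorAlgebra.ιMulti k r)).compLinearMap b'.equivFun.symm.toLinearMap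
  obtain ⟨N, hN, hN0⟩ := exists_common_zero hdim φ
  let u : Fin r → V := fun i => b'.equivFun.symm (N i)
  have hu : LinearIndependent k u :=
    hN.map' b'.equivFun.symm.toLinearMap (LinearEquiv.ker _)
  have hzero : ∀ y ∈ W, ψ (y * ExteriorAlgebra.ιMulti k r u) = 0 := by
    intro y hy
    have h1 : (ψ ∘ₗ LinearMap.mulRight k (ExteriorAlgebra.ιMulti k r u)) ∘ₗ W.subtype = 0 := by
      refine w.ext fun i => ?_
      exact hN0 i
    exact LinearMap.congr_fun h1 ⟨y, hy⟩
  have hvli : LinearIndependent k v := by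
    by_contra h
    exact hv0 (AlternatingMap.map_linearDependent _ v h)
  obtain ⟨g, hg⟩ := hthick (Submodule.span k (Set.range v)) (Submodule.span k (Set.range u))
    (by rw [finrank_span_eq_card hvli, Fintype.card_fin])
    (by rw [finrank_span_eq_card hu, Fintype.card_fin, Nat.add_sub_cancel_left])
  let gv : Fin m → V := fun i => ρ g (v i)
  have hgvW : ExteriorAlgebra.ιMulti k m gv ∈ W := by
    apply hinv g
    refine ⟨_, hvW, ?_⟩
    exact ExteriorAlgebra.map_apply_ιMulti _ _
  have h0 := hzero _ hgvW
  rw [ExteriorAlgebra.ιMulti_mul_ιMulti, hψ] at h0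
  have hspan : ⊤ ≤ Submodule.span k (Set.range (Fin.append gv u)) := by
    rw [← hg.sup_eq_top, Submodule.map_span, ← Submodule.span_union]
    apply Submodule.span_mono
    rintro _ (⟨_, ⟨i, rfl⟩, rfl⟩ | ⟨i, rfl⟩)
    · exact ⟨Fin.castAdd r i, by simp [gv]⟩
    · exact ⟨Fin.natAdd m i, by simp⟩
  have hli : LinearIndependent k (Fin.append gv u) :=
    linearIndependent_of_top_le_span_of_card_eq_finrank hspan (by simp [hn])
  have := (Module.Basis.is_basis_iff_det b).1 ⟨hli, top_le_iff.1 hspan⟩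
  rw [h0] at this
  exact not_isUnit_zero this
end

section
/- Let V be a 4-dimensional vector space over an algebraically closed field k and ρ: G → GL(V) a representation. Then ρ is thick if and only if ρ is irreducible and the induced representation ∧²ρ: G → GL(∧²V) has no G-invariant subspace W ⊂ ∧²V with 2 ≤ dim W ≤ 4. -/
open Module ExteriorAlgebra

variable {k G V : Type*} [Field k] [AddCommGroup V] [Module k V] [Group G]

section Coord

variable {K : Type*} [Field K]

/-- Plücker coordinates of a pair of vectors. -/
def pl (a b : Fin 4 → K) : Fin 6 → K :=
  ![a 0 * b 1 - a 1 * b 0, a 0 * b 2 - a 2 * b 0, a 0 * b 3 - a 3 * b 0,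
    a 1 * b 2 - a 2 * b 1, a 1 * b 3 - a 3 * b 1, a 2 * b 3 - a 3 * b 2]

/-- The wedge pairing in coordinates. -/
def wp (K : Type*) [Field K] : LinearMap.BilinForm K (Fin 6 → K) :=
  LinearMap.mk₂ K (fun p q => p 0 * q 5 - p 1 * q 4 + p 2 * q 3 + p 3 * q 2 - p 4 * q 1 + p 5 * q 0)
    (by intros; simp; ring) (by intros; simp; ring) (by intros; simp; ring) (by intros; simp; ring)

lemma wp_apply (p q : Fin 6 → K) : wp K p q =
    p 0 * q 5 - p 1 * q 4 + p 2 * q 3 + p 3 * q 2 - p 4 * q 1 + p 5 * q 0 := rfl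

lemma wp_symm (p q : Fin 6 → K) : wp K p q = wp K q p := by
  simp only [wp_apply]; ring

lemma wp_nondeg : (wp K).Nondegenerate := by
  have key : ∀ p : Fin 6 → K, (∀ q, wp K p q = 0) → p = 0 := by
    intro p h
    have h0 := h (Pi.single 0 1)
    have h1 := h (Pi.single 1 1)
    have h2 := h (Pi.single 2 1)
    have h3 := h (Pi.single 3 1)
    have h4 := h (Pi.single 4 1)
    have h5 := h (Pi.single 5 1)
    simp [wp_apply] at h0 h1 h2 h3 h4 h5
    ext i
    fin_cases i <;> simp [*]
  refine ⟨fun p h => key p h, fun p h => key p fun q => ?_⟩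
  rw [wp_symm]; exact h q

lemma wp_pl (a b c d : Fin 4 → K) :
    wp K (pl a b) (pl c d) = Matrix.det (Matrix.of ![a, b, c, d]) := by
  simp [wp_apply, pl, Matrix.det_succ_row_zero, Fin.sum_univ_succ, Fin.succAbove]
  ring

lemma wp_pl_ne (a b c d : Fin 4 → K) :
    wp K (pl a b) (pl c d) ≠ 0 ↔ LinearIndependent K ![a, b, c, d] := by
  rw [wp_pl, ← isUnit_iff_ne_zero, ← Matrix.isUnit_iff_isUnit_det,
    ← Matrix.linearIndependent_rows_iff_isUnit]
  rfl

/-- The Pfaffian. -/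
def pf (p : Fin 6 → K) : K := p 0 * p 5 - p 1 * p 4 + p 2 * p 3

lemma exists_pl (p : Fin 6 → K) (hp : p ≠ 0) (h : pf p = 0) : ∃ a b, pl a b = p := by
  obtain ⟨i, hi⟩ := Function.ne_iff.1 hp
  unfold pf at h
  let r0 : Fin 4 → K := ![0, p 0, p 1, p 2]
  let r1 : Fin 4 → K := ![-p 0, 0, p 3, p 4]
  let r2 : Fin 4 → K := ![-p 1, -p 3, 0, p 5]
  let r3 : Fin 4 → K := ![-p 2, -p 4, -p 5, 0]
  fin_cases i <;> simp at hi
  · refine ⟨(p 0)⁻¹ • r0, r1, ?_⟩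
    ext j
    fin_cases j <;> simp [pl, r0, r1] <;> field_simp <;>
      first | linear_combination h | linear_combination -h
  · refine ⟨(p 1)⁻¹ • r0, r2, ?_⟩
    ext j
    fin_cases j <;> simp [pl, r0, r2] <;> field_simp <;>
      first | linear_combination h | linear_combination -h
  · refine ⟨(p 2)⁻¹ • r0, r3, ?_⟩
    ext j
    fin_cases j <;> simp [pl, r0, r3] <;> field_simp <;>
      first | linear_combination h | linear_combination -h
  · refine ⟨(p 3)⁻¹ • r1, r2, ?_⟩
    ext j
    fin_cases j <;> simp [pl, r1, r2] <;> field_simp <;>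
      first | linear_combination h | linear_combination -h
  · refine ⟨(p 4)⁻¹ • r1, r3, ?_⟩
    ext j
    fin_cases j <;> simp [pl, r1, r3] <;> field_simp <;>
      first | linear_combination h | linear_combination -h
  · refine ⟨(p 5)⁻¹ • r2, r3, ?_⟩
    ext j
    fin_cases j <;> simp [pl, r2, r3] <;> field_simp <;>
      first | linear_combination h | linear_combination -h

lemma exists_pl_mem [IsAlgClosed K] (U : Submodule K (Fin 6 → K)) (hU : 2 ≤ Module.finrank K U) :
    ∃ a b, pl a b ∈ U ∧ pl a b ≠ 0 := by
  suffices h : ∃ p ∈ U, p ≠ 0 ∧ pf p = 0 by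
    obtain ⟨p, hp, h0, h⟩ := h
    obtain ⟨a, b, rfl⟩ := exists_pl p h0 h
    exact ⟨a, b, hp, h0⟩
  have : Nontrivial U := Module.nontrivial_of_finrank_pos (R := K) (by omega)
  obtain ⟨q, hq⟩ := exists_ne (0 : U)
  obtain ⟨p, hpq⟩ := exists_linearIndependent_pair_of_one_lt_finrank (R := K) (by omega) hq
  by_cases h0 : pf (q : Fin 6 → K) = 0
  · exact ⟨q, q.2, by simpa using hq, h0⟩
  let P : Polynomial K := Polynomial.C (pf q.1) * Polynomial.X ^ 2 +
    Polynomial.C (wp K p.1 q.1) * Polynomial.X + Polynomial.C (pf p.1)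
  obtain ⟨t, ht⟩ := IsAlgClosed.exists_root P (by
    rw [Polynomial.degree_quadratic h0]; decide)
  refine ⟨p.1 + t • q.1, U.add_mem p.2 (U.smul_mem _ q.2), ?_, ?_⟩
  · intro h
    have := (LinearIndependent.pair_iff.1 hpq) t 1 (by
      ext1
      simp [← h, add_comm])
    exact one_ne_zero this.2
  · simp [P, wp_apply, pf] at ht
    simp [pf]
    linear_combination ht

lemma pl_eq_coord {a b c d : Fin 4 → K} {l : K} (h : pl c d = l • pl a b) (i j : Fin 4) :
    c i * d j - c j * d i = l * (a i * b j - a j * b i) := by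
  have h0 := congrFun h 0
  have h1 := congrFun h 1
  have h2 := congrFun h 2
  have h3 := congrFun h 3
  have h4 := congrFun h 4
  have h5 := congrFun h 5
  simp [pl] at h0 h1 h2 h3 h4 h5
  fin_cases i <;> fin_cases j <;> simp <;> first
    | assumption
    | linear_combination -h0
    | linear_combination -h1
    | linear_combination -h2
    | linear_combination -h3
    | linear_combination -h4
    | linear_combination -h5

lemma pl_ne_coord {a b : Fin 4 → K} (h : pl a b ≠ 0) : ∃ i j, a i * b j - a j * b i ≠ 0 := by
  by_contra! hc
  apply h
  ext i
  fin_cases i <;> simp [pl, hc]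

lemma pl_ne_iff (a b : Fin 4 → K) : pl a b ≠ 0 ↔ LinearIndependent K ![a, b] := by
  constructor
  · intro h
    obtain ⟨i, j, hij⟩ := pl_ne_coord h
    rw [LinearIndependent.pair_iff]
    intro s t hst
    have hi := congrFun hst i
    have hj := congrFun hst j
    simp at hi hj
    constructor
    · refine (mul_eq_zero.1 (?_ : s * _ = 0)).resolve_right hij
      linear_combination b j * hi - b i * hj
    · refine (mul_eq_zero.1 (?_ : t * _ = 0)).resolve_right hij
      linear_combination a i * hj - a j * hi
  · intro hl h
    have h' : pl a b = (0 : K) • pl a b := by simp [h]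
    have := pl_eq_coord h'
    simp at this
    rw [LinearIndependent.pair_iff] at hl
    have : a = 0 := by
      ext i
      refine (hl (- b i) (a i) ?_).2
      ext j
      simp; linear_combination this i j
    exact one_ne_zero (hl 1 0 (by simp [this])).1

lemma mem_span_of_pl_eq {a b c d : Fin 4 → K} {l : K} (h : pl c d = l • pl a b)
    (hne : pl c d ≠ 0) : c ∈ Submodule.span K {a, b} ∧ d ∈ Submodule.span K {a, b} := by
  obtain ⟨i, j, hij⟩ := pl_ne_coord hne
  have hc := pl_eq_coord h
  set w := c i * d j - c j * d i with hw
  constructor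
  · rw [Submodule.mem_span_pair]
    refine ⟨w⁻¹ * l * (- c j * b i + c i * b j), w⁻¹ * l * (c j * a i - c i * a j), ?_⟩
    ext m
    simp
    field_simp
    linear_combination c i * hc j m - c j * hc i m + c m * hw
  · rw [Submodule.mem_span_pair]
    refine ⟨w⁻¹ * l * (- d j * b i + d i * b j), w⁻¹ * l * (d j * a i - d i * a j), ?_⟩
    ext m
    simp
    field_simp
    linear_combination d i * hc j m - d j * hc i m + d m * hw

end Coord
section Ext

variable {K E : Type*} [Field K] [AddCommGroup E] [Module K E]

lemma exists_phi (e : Module.Basis (Fin 4) K E) :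
    ∃ φ : (Fin 6 → K) →ₗ[K] ExteriorAlgebra K E, Function.Injective φ ∧
      LinearMap.range φ = ⋀[K]^2 E ∧
      ∀ a b : E, φ (pl (e.equivFun a) (e.equivFun b)) =
        ExteriorAlgebra.ι K a * ExteriorAlgebra.ι K b := by
  have : FiniteDimensional K E := e.finiteDimensional_of_finite
  let x : Fin 4 → ExteriorAlgebra K E := fun i => ExteriorAlgebra.ι K (e i)
  let φ : (Fin 6 → K) →ₗ[K] ExteriorAlgebra K E :=
    Fintype.linearCombination K ![x 0 * x 1, x 0 * x 2, x 0 * x 3, x 1 * x 2, x 1 * x 3, x 2 * x 3]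
  have hφ : ∀ a b : E, φ (pl (e.equivFun a) (e.equivFun b)) =
        ExteriorAlgebra.ι K a * ExteriorAlgebra.ι K b := by
    intro a b
    have hx : ∀ a : E, ExteriorAlgebra.ι K a = ∑ i, e.equivFun a i • x i := by
      intro a
      conv_lhs => rw [← e.sum_equivFun a]
      simp only [map_sum, map_smul, x]
    have hsq : ∀ i, x i * x i = 0 := fun i => ExteriorAlgebra.ι_sq_zero _
    have hsw : ∀ i j, x j * x i = - (x i * x j) := fun i j => by
      have := ExteriorAlgebra.ι_add_mul_swap (R := K) (e i) (e j)
      exact eq_neg_of_add_eq_zero_right this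
    rw [hx a, hx b]
    generalize e.equivFun a = u
    generalize e.equivFun b = v
    simp only [Fin.sum_univ_four, mul_add, add_mul, smul_mul_smul_comm, hsq, hsw 0 1, hsw 0 2,
      hsw 0 3, hsw 1 2, hsw 1 3, hsw 2 3]
    simp [φ, Fintype.linearCombination_apply, Fin.sum_univ_six, pl]
    module
  have hr : LinearMap.range φ = ⋀[K]^2 E := by
    apply le_antisymm
    · rintro _ ⟨p, rfl⟩
      have hm : ∀ i j, x i * x j ∈ ⋀[K]^2 E := by
        intro i j
        have := ExteriorAlgebra.ιMulti_range K (M := E) 2 ⟨![e i, e j], rfl⟩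
        simpa [ExteriorAlgebra.ιMulti_apply, x] using this
      simp only [φ, Fintype.linearCombination_apply]
      refine Submodule.sum_mem _ fun i _ => Submodule.smul_mem _ _ ?_
      fin_cases i <;> exact hm _ _
    · rw [← ExteriorAlgebra.ιMulti_span_fixedDegree, Submodule.span_le]
      rintro _ ⟨v, rfl⟩
      refine ⟨_, (hφ (v 0) (v 1)).trans ?_⟩
      simp [ExteriorAlgebra.ιMulti_apply, Matrix.vecTail]
  refine ⟨φ, ?_, hr, hφ⟩
  have h1 := LinearMap.finrank_range_add_finrank_ker φ
  rw [hr, exteriorPower.finrank_eq, Module.finrank_eq_card_basis e] at h1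
  simp [Nat.choose] at h1
  rw [← LinearMap.ker_eq_bot]
  exact h1

lemma finrank_comap_phi {φ : (Fin 6 → K) →ₗ[K] ExteriorAlgebra K E} (hi : Function.Injective φ)
    (W : Submodule K (ExteriorAlgebra K E)) (hW : W ≤ LinearMap.range φ) :
    Module.finrank K (W.comap φ) = Module.finrank K W := by
  have := (Submodule.equivMapOfInjective φ hi (W.comap φ)).finrank_eq
  rw [this, Submodule.map_comap_eq, inf_eq_right.2 hW]

lemma pl_ne_iff' (e : Module.Basis (Fin 4) K E) (a b : E) :
    pl (e.equivFun a) (e.equivFun b) ≠ 0 ↔ LinearIndependent K ![a, b] := by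
  rw [pl_ne_iff, ← LinearMap.linearIndependent_iff (e.equivFun : E →ₗ[K] (Fin 4 → K))
    e.equivFun.ker]
  rw [show ((e.equivFun : E →ₗ[K] (Fin 4 → K)) ∘ ![a, b]) = ![e.equivFun a, e.equivFun b] by
    ext i; fin_cases i <;> rfl]

lemma wp_ne_iff' (e : Module.Basis (Fin 4) K E) (a b c d : E) :
    wp K (pl (e.equivFun a) (e.equivFun b)) (pl (e.equivFun c) (e.equivFun d)) ≠ 0 ↔
      LinearIndependent K ![a, b, c, d] := by
  rw [wp_pl_ne, ← LinearMap.linearIndependent_iff (e.equivFun : E →ₗ[K] (Fin 4 → K))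
    e.equivFun.ker]
  rw [show ((e.equivFun : E →ₗ[K] (Fin 4 → K)) ∘ ![a, b, c, d]) =
      ![e.equivFun a, e.equivFun b, e.equivFun c, e.equivFun d] by
    ext i; fin_cases i <;> rfl]

lemma mem_span_of_pl_eq' (e : Module.Basis (Fin 4) K E) {a b c d : E} {l : K}
    (h : pl (e.equivFun c) (e.equivFun d) = l • pl (e.equivFun a) (e.equivFun b))
    (hne : pl (e.equivFun c) (e.equivFun d) ≠ 0) :
    c ∈ Submodule.span K {a, b} ∧ d ∈ Submodule.span K {a, b} := by
  have := mem_span_of_pl_eq h hne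
  simp only [Submodule.mem_span_pair, ← map_smul, ← map_add, e.equivFun.injective.eq_iff] at this ⊢
  exact this

lemma finrank_span_pair_indep {a b : E} (h : LinearIndependent K ![a, b]) :
    Module.finrank K (Submodule.span K {a, b}) = 2 := by
  have := finrank_span_eq_card h
  rwa [show Set.range ![a, b] = {a, b} by ext; simp [eq_comm, or_comm],
    Fintype.card_fin] at this

lemma isCompl_span_iff [FiniteDimensional K E] (h4 : Module.finrank K E = 4) {a b c d : E}
    (hab : LinearIndependent K ![a, b]) (hcd : LinearIndependent K ![c, d]) :
    IsCompl (Submodule.span K {a, b}) (Submodule.span K {c, d}) ↔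
      LinearIndependent K ![a, b, c, d] := by
  rw [Submodule.isCompl_iff_disjoint _ _ (by rw [finrank_span_pair_indep hab, finrank_span_pair_indep hcd, h4]), Submodule.disjoint_def]
  rw [LinearIndependent.pair_iff] at hab hcd
  simp only [Submodule.mem_span_pair]
  rw [Fintype.linearIndependent_iff]
  constructor
  · intro h g hg
    simp [Fin.sum_univ_four] at hg
    have h0 := h (g 0 • a + g 1 • b) ⟨_, _, rfl⟩ ⟨- g 2, - g 3, by
      rw [← sub_eq_zero, ← neg_eq_zero, ← hg]; module⟩
    have h1 := hab _ _ h0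
    have h2 := hcd (g 2) (g 3) (by rw [← hg, h1.1, h1.2]; module)
    intro i
    fin_cases i
    exacts [h1.1, h1.2, h2.1, h2.2]
  · rintro h x ⟨s, t, rfl⟩ ⟨u, v, huv⟩
    have := h ![s, t, -u, -v] (by
      simp [Fin.sum_univ_four]
      rw [← sub_eq_zero, ← neg_eq_zero] at huv
      rw [← huv]; module)
    have h0 := this 0
    have h1 := this 1
    simp at h0 h1
    simp [h0, h1]

lemma exists_pair_of_finrank_two (U : Submodule K E) (h : Module.finrank K U = 2) :
    ∃ a b : E, LinearIndependent K ![a, b] ∧ U = Submodule.span K {a, b} := by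
  have : FiniteDimensional K U := Module.finite_of_finrank_pos (by omega)
  let e := Module.finBasisOfFinrankEq K U h
  have hl : LinearIndependent K ![(e 0 : E), (e 1 : E)] := by
    have := e.linearIndependent.map' U.subtype (Submodule.ker_subtype _)
    rwa [show (U.subtype ∘ e) = ![(e 0 : E), (e 1 : E)] by ext i; fin_cases i <;> rfl] at this
  refine ⟨e 0, e 1, hl, ?_⟩
  symm
  apply Submodule.eq_of_le_of_finrank_eq
  · rw [Submodule.span_le]
    rintro x (rfl | rfl)
    exacts [(e 0).2, (e 1).2]
  · rw [h, finrank_span_pair_indep hl]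

end Ext
section Main

variable {K H E : Type*} [Field K] [Group H] [AddCommGroup E] [Module K E]

lemma rho_inv_apply (ρ : H →* (E ≃ₗ[K] E)) (g : H) (v : E) : ρ g (ρ g⁻¹ v) = v := by
  rw [← LinearEquiv.mul_apply, ← map_mul]; simp

lemma rho_inv_apply' (ρ : H →* (E ≃ₗ[K] E)) (g : H) (v : E) : ρ g⁻¹ (ρ g v) = v := by
  rw [← LinearEquiv.mul_apply, ← map_mul]; simp

lemma oneThick_of_irred [FiniteDimensional K E] (h4 : Module.finrank K E = 4)
    (ρ : H →* (E ≃ₗ[K] E)) (hρ : IsIrreducibleRep ρ) : IsMThick ρ 4 1 := by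
  intro V₁ V₂ h1 h2
  by_contra! hc
  obtain ⟨v, hv, hs⟩ := finrank_eq_one_iff'.1 h1
  have hV₁ : V₁ = Submodule.span K {(v : E)} := by
    apply le_antisymm
    · intro x hx
      obtain ⟨c, hc⟩ := hs ⟨x, hx⟩
      rw [Submodule.mem_span_singleton]
      exact ⟨c, congrArg Subtype.val hc⟩
    · rw [Submodule.span_singleton_le_iff_mem]; exact v.2
  have hv0 : (v : E) ≠ 0 := by simpa using hv
  have hmem : ∀ g, ρ g v ∈ V₂ := by
    intro g
    by_contra hg
    apply hc g
    rw [Submodule.isCompl_iff_disjoint, hV₁, Submodule.map_span, Set.image_singleton]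
    · rw [disjoint_comm]
      erw [Submodule.disjoint_span_singleton']
      · exact hg
      · simpa using hv0
    · rw [LinearEquiv.finrank_map_eq, h1, h2, h4]
  have hinv : RepInvariant ρ (Submodule.span K (Set.range fun g => ρ g (v : E))) := by
    intro h
    rw [Submodule.map_span, Submodule.span_le]
    rintro _ ⟨_, ⟨g, rfl⟩, rfl⟩
    refine Submodule.subset_span ⟨h * g, ?_⟩
    simp
  rcases hρ.2 _ hinv with h | h
  · have : ρ 1 (v : E) ∈ Submodule.span K (Set.range fun g => ρ g (v : E)) :=
      Submodule.subset_span ⟨1, rfl⟩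
    rw [h] at this
    simp at this
    exact hv this
  · have hle : Submodule.span K (Set.range fun g => ρ g (v : E)) ≤ V₂ := by
      rw [Submodule.span_le]; rintro _ ⟨g, rfl⟩; exact hmem g
    rw [h, top_le_iff] at hle
    rw [hle, finrank_top, h4] at h2
    omega

lemma isCompl_map_inv (ρ : H →* (E ≃ₗ[K] E)) (g : H) (A B : Submodule K E)
    (h : IsCompl (A.map (ρ g : E →ₗ[K] E)) B) : IsCompl (B.map (ρ g⁻¹ : E →ₗ[K] E)) A := by
  have hA : A = (A.map (ρ g : E →ₗ[K] E)).map (ρ g⁻¹ : E →ₗ[K] E) := by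
    apply SetLike.ext
    intro x
    constructor
    · intro hx
      exact ⟨ρ g x, ⟨x, hx, rfl⟩, rho_inv_apply' ρ g x⟩
    · rintro ⟨_, ⟨y, hy, rfl⟩, rfl⟩
      rw [LinearEquiv.coe_coe, LinearEquiv.coe_coe, rho_inv_apply']
      exact hy
  rw [hA]
  exact ((Submodule.orderIsoMapComap (ρ g⁻¹)).isCompl_iff.1 h).symm

lemma threeThick_of_oneThick (ρ : H →* (E ≃ₗ[K] E)) (h : IsMThick ρ 4 1) : IsMThick ρ 4 3 := by
  intro V₁ V₂ h1 h2
  obtain ⟨g, hg⟩ := h V₂ V₁ h2 h1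
  exact ⟨g⁻¹, isCompl_map_inv ρ g _ _ hg⟩

lemma irred_of_oneThick [FiniteDimensional K E] (h4 : Module.finrank K E = 4)
    (ρ : H →* (E ≃ₗ[K] E)) (hρ : IsMThick ρ 4 1) : IsIrreducibleRep ρ := by
  refine ⟨Module.nontrivial_of_finrank_pos (R := K) (by omega), fun W hW => ?_⟩
  by_contra! hc
  obtain ⟨v, hv, hv0⟩ := Submodule.exists_mem_ne_zero_of_ne_bot hc.1
  obtain ⟨f, hf, hWf⟩ := W.exists_le_ker_of_lt_top hc.2.lt_top
  have hk : Module.finrank K (LinearMap.ker f) = 4 - 1 := by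
    have := Module.Dual.finrank_ker_add_one_of_ne_zero hf
    omega
  obtain ⟨g, hg⟩ := hρ (Submodule.span K {v}) _ (finrank_span_singleton hv0) hk
  have h0 : ρ g v ∈ W := hW g ⟨v, hv, rfl⟩
  have := Submodule.disjoint_def.1 hg.disjoint (ρ g v)
    ⟨v, Submodule.mem_span_singleton_self v, rfl⟩ (hWf h0)
  simp at this
  exact hv0 this

lemma indep_map (ρ : H →* (E ≃ₗ[K] E)) (g : H) {a b : E} (h : LinearIndependent K ![a, b]) :
    LinearIndependent K ![ρ g a, ρ g b] := by
  have := h.map' (ρ g : E →ₗ[K] E) (ρ g).ker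
  rwa [show (((ρ g : E →ₗ[K] E)) ∘ ![a, b]) = ![ρ g a, ρ g b] by
    ext i; fin_cases i <;> rfl] at this

lemma map_span_pair' (ρ : H →* (E ≃ₗ[K] E)) (g : H) (a b : E) :
    (Submodule.span K {a, b}).map (ρ g : E →ₗ[K] E) = Submodule.span K {ρ g a, ρ g b} := by
  rw [Submodule.map_span, Set.image_pair]; rfl

/-- The span of the orbit of `a ∧ b`. -/
noncomputable def orbSpan (ρ : H →* (E ≃ₗ[K] E)) (a b : E) : Submodule K (ExteriorAlgebra K E) :=
  Submodule.span K (Set.range fun g => ExteriorAlgebra.ι K (ρ g a) * ExteriorAlgebra.ι K (ρ g b))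

lemma orbSpan_inv (ρ : H →* (E ≃ₗ[K] E)) (a b : E) (h : H) :
    (orbSpan ρ a b).map (extAction ρ h) ≤ orbSpan ρ a b := by
  unfold orbSpan
  rw [Submodule.map_span, Submodule.span_le]
  rintro _ ⟨_, ⟨g, rfl⟩, rfl⟩
  refine Submodule.subset_span ⟨h * g, ?_⟩
  simp [extAction]

lemma orbSpan_le (ρ : H →* (E ≃ₗ[K] E)) (a b : E) : orbSpan ρ a b ≤ ⋀[K]^2 E := by
  unfold orbSpan
  rw [Submodule.span_le]
  rintro _ ⟨g, rfl⟩
  have := ExteriorAlgebra.ιMulti_range K (M := E) 2 ⟨![ρ g a, ρ g b], rfl⟩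
  simpa [ExteriorAlgebra.ιMulti_apply] using this

lemma finrank_orbSpan_ne_one [FiniteDimensional K E] (h4 : Module.finrank K E = 4)
    (e : Module.Basis (Fin 4) K E) (ρ : H →* (E ≃ₗ[K] E))
    (hρ : IsIrreducibleRep ρ) {a b : E} (hab : LinearIndependent K ![a, b]) :
    Module.finrank K (orbSpan ρ a b) ≠ 1 := by
  intro h
  obtain ⟨φ, hi, hr, hφ⟩ := exists_phi e
  have hmem : ∀ g, ExteriorAlgebra.ι K (ρ g a) * ExteriorAlgebra.ι K (ρ g b) ∈ orbSpan ρ a b :=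
    fun g => Submodule.subset_span ⟨g, rfl⟩
  have h1 := hmem 1
  rw [map_one] at h1
  change ExteriorAlgebra.ι K a * ExteriorAlgebra.ι K b ∈ _ at h1
  have hne : ExteriorAlgebra.ι K a * ExteriorAlgebra.ι K b ≠ 0 := by
    rw [← hφ, Ne, map_eq_zero_iff φ hi]
    exact (pl_ne_iff' e a b).2 hab
  have hinv : RepInvariant ρ (Submodule.span K {a, b}) := by
    intro g
    obtain ⟨l, hl⟩ := (finrank_eq_one_iff_of_nonzero' (⟨_, h1⟩ : orbSpan ρ a b)
      (by simpa using hne)).1 h ⟨_, hmem g⟩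
    have hl' : l • (ExteriorAlgebra.ι K a * ExteriorAlgebra.ι K b) =
      ExteriorAlgebra.ι K (ρ g a) * ExteriorAlgebra.ι K (ρ g b) := congrArg Subtype.val hl
    rw [← hφ, ← hφ, ← map_smul] at hl'
    have := mem_span_of_pl_eq' e (hi hl').symm ((pl_ne_iff' e _ _).2 (indep_map ρ g hab))
    rw [map_span_pair', Submodule.span_le]
    rintro x (rfl | rfl)
    exacts [this.1, this.2]
  have h2 := finrank_span_pair_indep hab
  rcases hρ.2 _ hinv with h | h
  · rw [h] at h2; simp at h2
  · rw [h, finrank_top] at h2; omega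

lemma finrank_orbSpan_pos [FiniteDimensional K E]
    (e : Module.Basis (Fin 4) K E) (ρ : H →* (E ≃ₗ[K] E))
    {a b : E} (hab : LinearIndependent K ![a, b]) :
    Module.finrank K (orbSpan ρ a b) ≠ 0 := by
  intro h
  obtain ⟨φ, hi, hr, hφ⟩ := exists_phi e
  have hc := finrank_comap_phi hi (orbSpan ρ a b) (hr ▸ orbSpan_le ρ a b)
  rw [h, Submodule.finrank_eq_zero] at hc
  have h1 : ExteriorAlgebra.ι K (ρ 1 a) * ExteriorAlgebra.ι K (ρ 1 b) ∈ orbSpan ρ a b :=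
    Submodule.subset_span ⟨1, rfl⟩
  rw [← hφ, ← Submodule.mem_comap, hc, Submodule.mem_bot] at h1
  exact (pl_ne_iff' e _ _).2 (indep_map ρ 1 hab) h1

lemma twoThick [FiniteDimensional K E] (h4 : Module.finrank K E = 4)
    (ρ : H →* (E ≃ₗ[K] E)) (hρ : IsIrreducibleRep ρ)
    (hW : ∀ W : Submodule K (ExteriorAlgebra K E), W ≤ ⋀[K]^2 E →
          (∀ g : H, W.map (extAction ρ g) ≤ W) →
          ¬ (2 ≤ Module.finrank K W ∧ Module.finrank K W ≤ 4)) : IsMThick ρ 4 2 := by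
  intro V₁ V₂ h1 h2
  by_contra! hc
  let e := Module.finBasisOfFinrankEq K E h4
  obtain ⟨a, b, hab, rfl⟩ := exists_pair_of_finrank_two V₁ h1
  obtain ⟨c, d, hcd, rfl⟩ := exists_pair_of_finrank_two V₂ h2
  obtain ⟨φ, hi, hr, hφ⟩ := exists_phi e
  have horth : ∀ g h : H, wp K (pl (e.equivFun (ρ g a)) (e.equivFun (ρ g b)))
      (pl (e.equivFun (ρ h c)) (e.equivFun (ρ h d))) = 0 := by
    intro g h
    by_contra hne
    have hne := (wp_ne_iff' e _ _ _ _).1 hne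
    rw [← isCompl_span_iff h4 (indep_map ρ g hab) (indep_map ρ h hcd),
      ← map_span_pair', ← map_span_pair'] at hne
    apply hc (h⁻¹ * g)
    have := (isCompl_map_inv ρ h _ _ hne.symm)
    rw [← Submodule.map_comp] at this
    convert this using 2
    ext x
    simp
  have hA := finrank_comap_phi hi (orbSpan ρ a b) (hr ▸ orbSpan_le ρ a b)
  have hC := finrank_comap_phi hi (orbSpan ρ c d) (hr ▸ orbSpan_le ρ c d)
  have key : ∀ a b, (orbSpan ρ a b).comap φ = Submodule.span K
      (Set.range fun g => pl (e.equivFun (ρ g a)) (e.equivFun (ρ g b))) := by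
    intro a b
    rw [← Submodule.comap_map_eq_of_injective hi (Submodule.span K _), Submodule.map_span,
      ← Set.range_comp]
    simp only [Function.comp_def, hφ]
    rfl
  have hle : (orbSpan ρ c d).comap φ ≤ (wp K).orthogonal ((orbSpan ρ a b).comap φ) := by
    rw [key, key, Submodule.span_le]
    rintro _ ⟨h, rfl⟩
    intro p hp
    change wp K p _ = 0
    induction hp using Submodule.span_induction with
    | mem x hx => obtain ⟨g, rfl⟩ := hx; exact horth g h
    | zero => simp
    | add x y _ _ hx hy => simp only [map_add, LinearMap.add_apply, hx, hy, add_zero]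
    | smul t x _ hx => simp only [map_smul, LinearMap.smul_apply, hx, smul_zero]
  have h3 := Submodule.finrank_mono hle
  rw [LinearMap.BilinForm.finrank_orthogonal wp_nondeg, hA, hC, Module.finrank_fin_fun] at h3
  have h5 := hW _ (orbSpan_le ρ a b) (orbSpan_inv ρ a b)
  have h6 := hW _ (orbSpan_le ρ c d) (orbSpan_inv ρ c d)
  have h7 := finrank_orbSpan_ne_one h4 e ρ hρ hab
  have h8 := finrank_orbSpan_ne_one h4 e ρ hρ hcd
  have h9 := finrank_orbSpan_pos e ρ hab
  have h10 := finrank_orbSpan_pos e ρ hcd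
  omega

lemma no_inv_of_twoThick [IsAlgClosed K] [FiniteDimensional K E] (h4 : Module.finrank K E = 4)
    (ρ : H →* (E ≃ₗ[K] E)) (hρ : IsMThick ρ 4 2)
    (W : Submodule K (ExteriorAlgebra K E)) (hW : W ≤ ⋀[K]^2 E)
    (hinv : ∀ g : H, W.map (extAction ρ g) ≤ W) :
    ¬ (2 ≤ Module.finrank K W ∧ Module.finrank K W ≤ 4) := by
  rintro ⟨h2, h4'⟩
  let e := Module.finBasisOfFinrankEq K E h4
  obtain ⟨φ, hi, hr, hφ⟩ := exists_phi e
  have hA := finrank_comap_phi hi W (hr ▸ hW)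
  have ex : ∀ U : Submodule K (Fin 6 → K), 2 ≤ Module.finrank K U →
      ∃ a b : E, pl (e.equivFun a) (e.equivFun b) ∈ U ∧ LinearIndependent K ![a, b] := by
    intro U hU
    obtain ⟨a, b, h, h0⟩ := exists_pl_mem U hU
    refine ⟨e.equivFun.symm a, e.equivFun.symm b, ?_, ?_⟩
    · simpa only [LinearEquiv.apply_symm_apply] using h
    · rw [← pl_ne_iff' e]
      simpa only [LinearEquiv.apply_symm_apply] using h0
  obtain ⟨a, b, hab, hab'⟩ := ex (W.comap φ) (by omega)
  obtain ⟨c, d, hcd, hcd'⟩ := ex ((wp K).orthogonal (W.comap φ)) (by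
    rw [LinearMap.BilinForm.finrank_orthogonal wp_nondeg, Module.finrank_fin_fun]
    omega)
  obtain ⟨g, hg⟩ := hρ (Submodule.span K {a, b}) (Submodule.span K {c, d})
    (finrank_span_pair_indep hab') (finrank_span_pair_indep hcd')
  rw [map_span_pair', isCompl_span_iff h4 (indep_map ρ g hab') hcd', ← wp_ne_iff' e] at hg
  apply hg
  refine hcd _ ?_
  rw [Submodule.mem_comap, hφ] at hab ⊢
  refine hinv g ⟨_, hab, ?_⟩
  simp [extAction]

end Main

/-- a 4-dimensional representation over an algebraically closed
field is thick iff it is irreducible and `⋀² V` has no G-invariant subspace of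
dimension between 2 and 4. -/
theorem thick_iff_four_dim {k G V : Type*} [Field k] [IsAlgClosed k]
    [AddCommGroup V] [Module k V] [Group G] [FiniteDimensional k V]
    (h4 : Module.finrank k V = 4) (ρ : G →* (V ≃ₗ[k] V)) :
    (∀ m : ℕ, 0 < m → m < 4 → IsMThick ρ 4 m) ↔
      (IsIrreducibleRep ρ ∧
        ∀ W : Submodule k (ExteriorAlgebra k V), W ≤ ⋀[k]^2 V →
          (∀ g : G, W.map (extAction ρ g) ≤ W) →
          ¬ (2 ≤ Module.finrank k W ∧ Module.finrank k W ≤ 4)) := by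
  constructor
  · intro h
    exact ⟨irred_of_oneThick h4 ρ (h 1 (by norm_num) (by norm_num)),
      fun W hW hinv => no_inv_of_twoThick h4 ρ (h 2 (by norm_num) (by norm_num)) W hW hinv⟩
  · rintro ⟨hρ, hW⟩ m h0 hm
    have h1 := oneThick_of_irred h4 ρ hρ
    interval_cases m
    · exact h1
    · exact twoThick h4 ρ hρ hW
    · exact threeThick_of_oneThick ρ h1
end
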